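/- arXiv:2004.15025 — 2 statements merged into one kernel-verified Lean document; each statement's English description precedes it below -/
import Mathlib

section
/- The map φ ↦ (φ + h)/2 is a bijection from the set of graph homomorphisms ℤ^d → ℤ onto the set of q-Lipschitz functions ℤ^d → ℤ. -/
noncomputable section

/-- The lattice `ℤ^d`. -/
abbrev V (d : ℕ) := Fin d → ℤ

/-- Nearest-neighbour graph distance `d₁` on `ℤ^d`. -/
def dist1 {d : ℕ} (x y : V d) : ℕ := ∑ i, (x i - y i).natAbs

/-- `h(x) = Σ_i x_i`. -/
def hgt {d : ℕ} (x : V d) : ℤ := ∑ i, x i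

/-- `q(x, y) = Σ_i max(0, (y - x)_i)`. -/
def q17 {d : ℕ} (x y : V d) : ℤ := ∑ i, max 0 (y i - x i)
theorem hgt_add_single {d : ℕ} (x : V d) (i : Fin d) :
    hgt (x + Pi.single i 1) = hgt x + 1 := by
  simp [hgt, Finset.sum_add_distrib]

theorem dist1_comm {d : ℕ} (x y : V d) : dist1 x y = dist1 y x :=
  Finset.sum_congr rfl fun i _ => by omega

theorem dist1_add_single {d : ℕ} (x : V d) (i : Fin d) :
    dist1 x (x + Pi.single i 1) = 1 := by
  simp only [dist1]
  rw [Finset.sum_eq_single i]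
  · simp
  · intro j _ hj
    simp [hj]
  · simp

/-- Two lattice points at distance one differ by a coordinate vector. -/
theorem exists_eq_add_single_of_dist1_eq_one {d : ℕ} {x y : V d} (h : dist1 x y = 1) :
    ∃ i, y = x + Pi.single i 1 ∨ x = y + Pi.single i 1 := by
  obtain ⟨i, -, hi⟩ : ∃ i ∈ Finset.univ, (x i - y i).natAbs ≠ 0 :=
    Finset.exists_ne_zero_of_sum_ne_zero (by rw [dist1] at h; omega)
  have hsum := Finset.add_sum_erase Finset.univ (fun j => (x j - y j).natAbs) (Finset.mem_univ i)
  rw [dist1] at h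
  have hz : ∑ j ∈ Finset.univ.erase i, (x j - y j).natAbs = 0 := by
    omega
  have hne : ∀ j, j ≠ i → x j = y j := by
    intro j hj
    have := Finset.sum_eq_zero_iff.1 hz j (by simp [hj])
    omega
  have hone : (x i - y i).natAbs = 1 := by
    omega
  refine ⟨i, ?_⟩
  rcases Int.natAbs_eq_iff.1 hone with h1 | h1
  · right
    funext j
    rcases eq_or_ne j i with rfl | hj
    · simp only [Pi.add_apply, Pi.single_eq_same]
      push_cast at h1
      omega
    · simp [hj, hne j hj]
  · left
    funext j
    rcases eq_or_ne j i with rfl | hj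
    · simp only [Pi.add_apply, Pi.single_eq_same]
      push_cast at h1
      omega
    · simp [hj, hne j hj]

/-- Induction along unit steps that lead away from `x`. -/
theorem monotone_path_induction {d : ℕ} (x : V d) {P : V d → Prop} (base : P x)
    (up : ∀ y i, x i ≤ y i → P y → P (y + Pi.single i 1))
    (down : ∀ y i, y i < x i → P (y + Pi.single i 1) → P y) (y : V d) : P y := by
  induction hn : dist1 x y generalizing y with
  | zero =>
    have hxy : x = y := by
      funext j
      have := Finset.sum_eq_zero_iff.1 hn j (Finset.mem_univ j)
      omega
    exact hxy ▸ base
  | succ n ih =>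
    obtain ⟨i, -, hi⟩ : ∃ i ∈ Finset.univ, (x i - y i).natAbs ≠ 0 :=
      Finset.exists_ne_zero_of_sum_ne_zero (by rw [dist1] at hn; omega)
    have closer : ∀ z : V d, (∀ j, j ≠ i → z j = y j) →
        (x i - z i).natAbs + 1 = (x i - y i).natAbs → dist1 x z = n := by
      intro z hz hzi
      have hy := Finset.add_sum_erase Finset.univ (fun j => (x j - y j).natAbs)
        (Finset.mem_univ i)
      have hz' := Finset.add_sum_erase Finset.univ (fun j => (x j - z j).natAbs)
        (Finset.mem_univ i)
      have he : ∑ j ∈ Finset.univ.erase i, (x j - z j).natAbs =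
          ∑ j ∈ Finset.univ.erase i, (x j - y j).natAbs :=
        Finset.sum_congr rfl fun j hj => by rw [hz j (Finset.ne_of_mem_erase hj)]
      rw [dist1] at hn ⊢
      omega
    rcases lt_or_ge (y i) (x i) with hlt | hge
    · refine down y i hlt (ih _ (closer _ (fun j hj => by simp [hj]) ?_))
      simp only [Pi.add_apply, Pi.single_eq_same]
      omega
    · have hstep := up (y - Pi.single i 1) i
        (by simp only [Pi.sub_apply, Pi.single_eq_same]; omega)
        (ih _ (closer _ (fun j hj => by simp [hj])
          (by simp only [Pi.sub_apply, Pi.single_eq_same]; omega)))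
      rwa [sub_add_cancel] at hstep

theorem q17_add_single_sub {d : ℕ} (x y : V d) (i : Fin d) :
    q17 x (y + Pi.single i 1) - q17 x y = max 0 (y i + 1 - x i) - max 0 (y i - x i) := by
  rw [q17, q17, ← Finset.sum_sub_distrib, Finset.sum_eq_single i]
  · simp
  · intro j _ hj
    simp [hj]
  · simp

theorem q17_self {d : ℕ} (x : V d) : q17 x x = 0 := by
  simp [q17]

/-- A function is `q`-Lipschitz iff its increments along coordinate vectors are `0` or `1`. -/
theorem forall_sub_le_q17_iff {d : ℕ} (ψ : V d → ℤ) :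
    (∀ x y : V d, ψ y - ψ x ≤ q17 x y) ↔
      ∀ x i, ψ x ≤ ψ (x + Pi.single i 1) ∧ ψ (x + Pi.single i 1) ≤ ψ x + 1 := by
  constructor
  · intro h x i
    have hup := h x (x + Pi.single i 1)
    have hdown := h (x + Pi.single i 1) x
    have hqup := q17_add_single_sub x x i
    have hqdown := q17_add_single_sub (x + Pi.single i 1) x i
    simp only [q17_self, Pi.add_apply, Pi.single_eq_same] at hqup hqdown
    omega
  · intro h x y
    refine monotone_path_induction x (P := fun y => ψ y - ψ x ≤ q17 x y) ?_ ?_ ?_ y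
    · simp [q17_self]
    · intro y i hi hy
      have := h y i
      have := q17_add_single_sub x y i
      omega
    · intro y i hi hy
      have := h y i
      have := q17_add_single_sub x y i
      omega

theorem hgt_zero {d : ℕ} : hgt (0 : V d) = 0 := by
  simp [hgt]

/-- A graph homomorphism has the same parity as `h`. -/
theorem two_dvd_add_hgt {d : ℕ} {φ : V d → ℤ} (h0 : ∃ k : ℤ, φ 0 = 2 * k)
    (hφ : ∀ x y : V d, dist1 x y = 1 → |φ y - φ x| = 1) (x : V d) : 2 ∣ φ x + hgt x := by
  have step : ∀ (y : V d) i, 2 ∣ φ y + hgt y ↔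
      2 ∣ φ (y + Pi.single i 1) + hgt (y + Pi.single i 1) := by
    intro y i
    have := (abs_eq zero_le_one).1 (hφ _ _ (dist1_add_single y i))
    rw [hgt_add_single]
    omega
  refine monotone_path_induction 0 (P := fun x => 2 ∣ φ x + hgt x) ?_
    (fun y i _ => (step y i).1) (fun y i _ => (step y i).2) x
  rw [hgt_zero, add_zero]
  exact h0

theorem two_mul_fdiv_add_hgt {d : ℕ} {φ : V d → ℤ} (h0 : ∃ k : ℤ, φ 0 = 2 * k)
    (hφ : ∀ x y : V d, dist1 x y = 1 → |φ y - φ x| = 1) (x : V d) :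
    2 * Int.fdiv (φ x + hgt x) 2 = φ x + hgt x :=
  Int.mul_fdiv_cancel' (two_dvd_add_hgt h0 hφ x)

/-- the map `φ ↦ (φ + h)/2` is a bijection from the set of graph
homomorphisms `ℤ^d → ℤ` onto the set of `q`-Lipschitz functions `ℤ^d → ℤ`. -/
theorem statement17 (d : ℕ) (hd : 1 ≤ d) :
    Set.BijOn (fun (φ : V d → ℤ) => fun x => Int.fdiv (φ x + hgt x) 2)
      {φ : V d → ℤ | (∃ k : ℤ, φ 0 = 2 * k) ∧
        ∀ x y : V d, dist1 x y = 1 → |φ y - φ x| = 1}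
      {ψ : V d → ℤ | ∀ x y : V d, ψ y - ψ x ≤ q17 x y} := by
  refine ⟨?_, ?_, ?_⟩
  · rintro φ ⟨h0, hφ⟩
    refine (forall_sub_le_q17_iff _).2 fun x i => ?_
    have hx := two_mul_fdiv_add_hgt h0 hφ x
    have hxi := two_mul_fdiv_add_hgt h0 hφ (x + Pi.single i 1)
    have habs := (abs_eq zero_le_one).1 (hφ _ _ (dist1_add_single x i))
    have hh := hgt_add_single x i
    dsimp only
    omega
  · rintro φ ⟨h0, hφ⟩ φ' ⟨h0', hφ'⟩ heq
    funext x
    have hx := two_mul_fdiv_add_hgt h0 hφ x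
    have hx' := two_mul_fdiv_add_hgt h0' hφ' x
    have := congrFun heq x
    dsimp only at this
    omega
  · intro ψ hψ
    have hstep := (forall_sub_le_q17_iff ψ).1 hψ
    refine ⟨fun x => 2 * ψ x - hgt x, ⟨⟨ψ 0, by simp [hgt_zero]⟩, ?_⟩, ?_⟩
    · intro x y hxy
      obtain ⟨i, rfl | rfl⟩ := exists_eq_add_single_of_dist1_eq_one hxy
      · have := hstep x i
        have := hgt_add_single x i
        refine (abs_eq zero_le_one).2 ?_
        dsimp only
        omega
      · have := hstep y i
        have := hgt_add_single y i
        refine (abs_eq zero_le_one).2 ?_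
        dsimp only
        omega
    · funext x
      simp

end
end

section
/- Suppose Δ ⊊ ℤ^d is *-connected and cofinite (ℤ^d∖Δ is finite) with ℤ^d∖Δ connected. Then the set of graph homomorphisms φ: ℤ^d → ℤ for which Δ is the outside of an n-level set of φ for some n ∈ ℤ equals the set of graph homomorphisms φ for which there exists n ∈ ℤ with φ = n − 1 at every vertex of ∂*Δ ∩ Δ and φ ≥ n at every vertex of ∂*Δ ∖ Δ. Moreover, for any graph homomorphism φ, no two distinct finite level sets of φ have the same outside. -/
open Set

noncomputable section

/-- Nearest-neighbour adjacency. -/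
def adj1 {d : ℕ} (x y : V d) : Prop := dist1 x y = 1

/-- `*`-adjacency: `‖x - y‖_∞ = 1`. -/
def adjS {d : ℕ} (x y : V d) : Prop := x ≠ y ∧ ∀ i, (x i - y i).natAbs ≤ 1

/-- The nearest-neighbour connected component of `x` inside `s`. -/
def compIn {d : ℕ} (s : Set (V d)) (x : V d) : Set (V d) :=
  {y | Relation.ReflTransGen (fun a b => a ∈ s ∧ b ∈ s ∧ adj1 a b) x y}

/-- The `*`-connected component of `x` inside `s`. -/
def compInS {d : ℕ} (s : Set (V d)) (x : V d) : Set (V d) :=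
  {y | Relation.ReflTransGen (fun a b => a ∈ s ∧ b ∈ s ∧ adjS a b) x y}

/-- `s` is connected (nearest-neighbour graph). -/
def ConnSet {d : ℕ} (s : Set (V d)) : Prop := ∀ x ∈ s, ∀ y ∈ s, y ∈ compIn s x

/-- `s` is `*`-connected. -/
def ConnSetS {d : ℕ} (s : Set (V d)) : Prop := ∀ x ∈ s, ∀ y ∈ s, y ∈ compInS s x

/-- The boundary `∂*Δ`: vertices outside `Δ` that are `*`-adjacent to `Δ`, together with
vertices of `Δ` adjacent to the complement of `Δ`. -/
def starBd {d : ℕ} (Δ : Set (V d)) : Set (V d) :=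
  {x | (x ∉ Δ ∧ ∃ y ∈ Δ, adjS x y) ∨ (x ∈ Δ ∧ ∃ y : V d, y ∉ Δ ∧ adj1 x y)}

/-- Graph homomorphisms `ℤ^d → ℤ`. -/
def GH {d : ℕ} (φ : V d → ℤ) : Prop :=
  (∃ k : ℤ, φ 0 = 2 * k) ∧ ∀ x y : V d, dist1 x y = 1 → |φ y - φ x| = 1

/-- An `n`-level set of `φ`: a connected component of `{φ ≥ n}`. -/
def IsLevelSet {d : ℕ} (φ : V d → ℤ) (n : ℤ) (Lset : Set (V d)) : Prop :=
  ∃ x, x ∈ {z : V d | n ≤ φ z} ∧ Lset = compIn {z : V d | n ≤ φ z} x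

/-- The outside of a set: the unbounded `*`-connected component of the complement. -/
def outsideStar {d : ℕ} (Λ : Set (V d)) : Set (V d) :=
  {y | y ∉ Λ ∧ ¬ (compInS Λᶜ y).Finite}

theorem natAbs_sum_eq_one {ι : Type*} [Fintype ι] {f : ι → ℕ} (h : ∑ i, f i = 1) :
    ∃ i, f i = 1 ∧ ∀ j, j ≠ i → f j = 0 := by
  classical
  obtain ⟨i, -, hi⟩ := Finset.exists_ne_zero_of_sum_ne_zero (h.trans_ne one_ne_zero)
  have h1 := Finset.add_sum_erase Finset.univ f (Finset.mem_univ i)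
  rw [h] at h1
  have h2 : ∑ j ∈ Finset.univ.erase i, f j = 0 := by omega
  refine ⟨i, by omega, fun j hj => ?_⟩
  exact Finset.sum_eq_zero_iff.1 h2 j (by simp [hj])

theorem adj1.symm {d : ℕ} {x y : V d} (h : adj1 x y) : adj1 y x := by
  unfold adj1 dist1 at *
  rw [← h]
  exact Finset.sum_congr rfl fun i _ => by omega

theorem adjS.symm {d : ℕ} {x y : V d} (h : adjS x y) : adjS y x :=
  ⟨h.1.symm, fun i => by have := h.2 i; omega⟩

theorem adj1.adjS {d : ℕ} {x y : V d} (h : adj1 x y) : adjS x y := by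
  refine ⟨?_, fun i => ?_⟩
  · rintro rfl
    simp [adj1, dist1] at h
  · rw [← show dist1 x y = 1 from h]
    exact Finset.single_le_sum (f := fun i => (x i - y i).natAbs) (fun _ _ => Nat.zero_le _)
      (Finset.mem_univ i)

theorem adj1_add_single {d : ℕ} (x : V d) (i : Fin d) : adj1 x (x + Pi.single i 1) := by
  unfold adj1 dist1
  rw [Finset.sum_eq_single i]
  · simp
  · intro j _ hj
    simp [hj]
  · simp

theorem adj1_update {d : ℕ} (x : V d) (i : Fin d) (a : ℤ) (h : (x i - a).natAbs = 1) :
    adj1 x (Function.update x i a) := by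
  unfold adj1 dist1
  rw [Finset.sum_eq_single i]
  · simpa using h
  · intro j _ hj
    simp [hj]
  · simp

theorem adj1.exists_single {d : ℕ} {x y : V d} (h : adj1 x y) :
    ∃ i : Fin d, y = x + Pi.single i 1 ∨ x = y + Pi.single i 1 := by
  obtain ⟨i, hi, hj⟩ := natAbs_sum_eq_one h
  refine ⟨i, ?_⟩
  have hc : y i = x i + 1 ∨ x i = y i + 1 := by omega
  refine hc.imp (fun hc => ?_) (fun hc => ?_) <;>
  · funext j
    by_cases hji : j = i
    · subst hji
      simpa using hc
    · have := hj j hji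
      simp only [Pi.add_apply, Pi.single_eq_of_ne hji]
      omega

/-- A set of lattice points that no nearest-neighbour edge leaves is empty or everything. -/
theorem mem_iff_of_adj1 {d : ℕ} {S : Set (V d)} (hS : ∀ x y, adj1 x y → x ∈ S → y ∈ S)
    (x y : V d) : x ∈ S ↔ y ∈ S := by
  let H : AddSubgroup (V d) :=
    { carrier := {v | ∀ z, z + v ∈ S ↔ z ∈ S}
      zero_mem' := by simp
      add_mem' := fun {a b} ha hb z => by rw [← add_assoc, hb, ha]
      neg_mem' := fun {a} ha z => by rw [← ha (z + -a)]; simp }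
  have h1 : ∀ i, (Pi.single i 1 : V d) ∈ H := fun i z =>
    ⟨hS _ _ (adj1_add_single z i).symm, hS _ _ (adj1_add_single z i)⟩
  have h2 : ∀ v : V d, v ∈ H := fun v => by
    rw [← Finset.univ_sum_single v]
    refine H.sum_mem fun i _ => ?_
    have := H.zsmul_mem (h1 i) (v i)
    rwa [← Pi.single_smul, smul_eq_mul, mul_one] at this
  have := h2 (y - x) x
  rw [add_sub_cancel] at this
  exact this.symm

/-- A nonempty proper set of lattice points is left by some nearest-neighbour edge. -/
theorem exists_adj1_mem_notMem {d : ℕ} {S : Set (V d)} (h1 : S.Nonempty) (h2 : S ≠ univ) :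
    ∃ x ∈ S, ∃ y, y ∉ S ∧ adj1 x y := by
  by_contra! h
  obtain ⟨x, hx⟩ := h1
  refine h2 (eq_univ_of_forall fun y => (mem_iff_of_adj1 (fun a b hab ha => ?_) x y).1 hx)
  by_contra hb
  exact h a ha b hb hab

/-- Two points at sup-distance at most one are joined inside the unit cube they span. -/
theorem eq_of_cube {d : ℕ} {α : Type*} (g : V d → α) (x y : V d)
    (hxy : ∀ i, (x i - y i).natAbs ≤ 1)
    (hg : ∀ u v, (∀ i, u i = x i ∨ u i = y i) → (∀ i, v i = x i ∨ v i = y i) →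
      adj1 u v → g u = g v) : g x = g y := by
  classical
  have key : ∀ s : Finset (Fin d), g (s.piecewise y x) = g x := by
    intro s
    induction s using Finset.induction_on with
    | empty => simp
    | insert i s his ih =>
      rw [← ih, Finset.piecewise_insert]
      by_cases hi : x i = y i
      · congr 1
        conv_rhs => rw [← Function.update_eq_self i (s.piecewise y x)]
        simp [his, hi]
      · have hs : ∀ j, s.piecewise y x j = x j ∨ s.piecewise y x j = y j := fun j => by
          by_cases hj : j ∈ s <;> simp [hj]
        refine (hg _ _ hs (fun j => ?_) (adj1_update _ _ _ ?_)).symm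
        · by_cases hj : j = i
          · subst hj; simp
          · simpa [hj] using hs j
        · have := hxy i
          simp only [his, not_false_eq_true, Finset.piecewise_eq_of_notMem]
          omega
  simpa using (key Finset.univ).symm

/-- A 1-cochain on the edges of `ℤ^d` that is closed on unit squares is exact. -/
theorem exists_potential {d : ℕ} {A : Type*} [AddCommGroup A] (c : V d → Fin d → A)
    (hc : ∀ x i j, c x i + c (x + Pi.single i 1) j = c x j + c (x + Pi.single j 1) i) :
    ∃ h : V d → A, ∀ x i, h (x + Pi.single i 1) = h x + c x i := by
  let T : Fin d → Equiv.Perm (V d × A) := fun i =>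
    { toFun := fun p => (p.1 + Pi.single i 1, p.2 + c p.1 i)
      invFun := fun p => (p.1 - Pi.single i 1, p.2 - c (p.1 - Pi.single i 1) i)
      left_inv := fun p => by simp
      right_inv := fun p => by simp }
  have hT : ∀ i j, Commute (T i) (T j) := fun i j => Equiv.ext fun p => by
    refine Prod.ext (add_right_comm _ _ _) ?_
    change p.2 + c p.1 j + c (p.1 + Pi.single j 1) i = p.2 + c p.1 i + c (p.1 + Pi.single i 1) j
    rw [add_assoc, add_assoc, hc]
  let F : (Fin d → Multiplicative ℤ) →* Equiv.Perm (V d × A) :=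
    MonoidHom.noncommPiCoprod (fun i => zpowersHom _ (T i)) fun i j _ a b => by
      simpa [zpowersHom_apply] using ((hT i j).zpow_zpow _ _)
  have hF : ∀ (v : Fin d → Multiplicative ℤ) (i : Fin d),
      F (Pi.mulSingle i (Multiplicative.ofAdd (1 : ℤ)) * v) = T i * F v := fun v i => by
    rw [map_mul]
    congr 1
    exact (MonoidHom.noncommPiCoprod_mulSingle _ i _).trans (by simp)
  let G : V d → V d × A := fun x => F (fun i => Multiplicative.ofAdd (x i)) (0, 0)
  have hG : ∀ x i, G (x + Pi.single i 1) = T i (G x) := fun x i => by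
    change _ = (T i * F _) (0, 0)
    rw [← hF]
    change F _ (0, 0) = _
    congr 2
    funext j
    by_cases hj : j = i
    · subst hj
      simp [ofAdd_add, mul_comm]
    · simp [hj]
  have hG1 : ∀ x, (G x).1 = x := fun x => by
    refine (mem_iff_of_adj1 (S := {x | (G x).1 = x}) (fun a b hab ha => ?_) 0 x).1 ?_
    · obtain ⟨i, rfl | rfl⟩ := hab.exists_single
      · change (G _).1 = _
        rw [hG]
        exact congrArg (· + _) ha
      · have ha : (G _).1 = _ := ha
        rw [hG] at ha
        exact add_right_cancel ha
    · have : G 0 = (0, 0) := by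
        change F 1 (0, 0) = _
        simp
      exact congrArg Prod.fst this
  refine ⟨fun x => (G x).2, fun x i => ?_⟩
  change (G _).2 = _
  rw [hG]
  change (G x).2 + c (G x).1 i = _
  rw [hG1]

open Classical in
/-- The indicator, modulo two, of the pairs with one element in `Δ` and the other in `C \ Δ`. -/
def crossing {α : Type*} (Δ C : Set α) (x y : α) : ZMod 2 :=
  if (x ∈ Δ ∧ y ∉ Δ ∧ y ∈ C) ∨ (y ∈ Δ ∧ x ∉ Δ ∧ x ∈ C) then 1 else 0

theorem crossing_comm {α : Type*} (Δ C : Set α) (x y : α) :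
    crossing Δ C x y = crossing Δ C y x := by
  unfold crossing
  congr 1
  exact propext or_comm

theorem crossing_of_mem_iff_mem {α : Type*} {Δ : Set α} (C : Set α) {x y : α}
    (h : x ∈ Δ ↔ y ∈ Δ) : crossing Δ C x y = 0 := by
  unfold crossing
  rw [if_neg]
  tauto

open Classical in
theorem crossing_of_mem_of_notMem {α : Type*} {Δ : Set α} (C : Set α) {x y : α}
    (hx : x ∈ Δ) (hy : y ∉ Δ) : crossing Δ C x y = if y ∈ C then 1 else 0 := by
  unfold crossing
  congr 1
  simp [hx, hy]

open Classical in
theorem crossing_of_notMem_of_mem {α : Type*} {Δ : Set α} (C : Set α) {x y : α}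
    (hx : x ∉ Δ) (hy : y ∈ Δ) : crossing Δ C x y = if x ∈ C then 1 else 0 := by
  rw [crossing_comm, crossing_of_mem_of_notMem C hy hx]

theorem crossing_add_crossing {α : Type*} {Δ C : Set α} {x m n p : α}
    (h1 : p ∈ Δ → x ∉ Δ → m ∉ Δ → (x ∈ C ↔ m ∈ C))
    (h2 : p ∈ Δ → x ∉ Δ → n ∉ Δ → (x ∈ C ↔ n ∈ C))
    (h3 : n ∈ Δ → x ∉ Δ → m ∉ Δ → (x ∈ C ↔ m ∈ C))
    (h4 : m ∈ Δ → x ∉ Δ → n ∉ Δ → (x ∈ C ↔ n ∈ C))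
    (h5 : x ∈ Δ → m ∉ Δ → p ∉ Δ → (m ∈ C ↔ p ∈ C))
    (h6 : n ∈ Δ → m ∉ Δ → p ∉ Δ → (m ∈ C ↔ p ∈ C))
    (h7 : x ∈ Δ → n ∉ Δ → p ∉ Δ → (n ∈ C ↔ p ∈ C))
    (h8 : m ∈ Δ → n ∉ Δ → p ∉ Δ → (n ∈ C ↔ p ∈ C)) :
    crossing Δ C x m + crossing Δ C m p = crossing Δ C x n + crossing Δ C n p := by
  have t : (1 : ZMod 2) + 1 = 0 := rfl
  by_cases hx : x ∈ Δ <;> by_cases hm : m ∈ Δ <;> by_cases hn : n ∈ Δ <;> by_cases hp : p ∈ Δ <;>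
    simp [hx, hm, hn, hp, crossing_of_mem_iff_mem, crossing_of_mem_of_notMem,
      crossing_of_notMem_of_mem] at h1 h2 h3 h4 h5 h6 h7 h8 ⊢ <;>
    simp_all <;> split_ifs <;> simp_all

/-- The `*`-boundary of a `*`-connected set with connected complement is nearest-neighbour
connected on its outer side. -/
theorem mem_of_mem_starBd_diff {d : ℕ} {Δ C : Set (V d)} (hstar : ConnSetS Δ)
    (hconn : ConnSet Δᶜ)
    (hC : ∀ u v, u ∈ starBd Δ \ Δ → v ∈ starBd Δ \ Δ → adj1 u v → u ∈ C → v ∈ C)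
    {u v : V d} (hu : u ∈ starBd Δ \ Δ) (hv : v ∈ starBd Δ \ Δ) (huC : u ∈ C) : v ∈ C := by
  classical
  have hB : ∀ {a b : V d}, a ∈ Δ → b ∉ Δ → (∀ i, (a i - b i).natAbs ≤ 1) →
      b ∈ starBd Δ \ Δ := fun {a b} ha hb hab =>
    ⟨Or.inl ⟨hb, a, ha, adjS.symm ⟨fun h => hb (h ▸ ha), hab⟩⟩, hb⟩
  have hC' : ∀ {a b z : V d}, z ∈ Δ → a ∉ Δ → b ∉ Δ → (∀ i, (z i - a i).natAbs ≤ 1) →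
      (∀ i, (z i - b i).natAbs ≤ 1) → adj1 a b → (a ∈ C ↔ b ∈ C) :=
    fun hz ha hb hza hzb hab =>
      ⟨hC _ _ (hB hz ha hza) (hB hz hb hzb) hab, hC _ _ (hB hz hb hzb) (hB hz ha hza) hab.symm⟩
  obtain ⟨h, hh⟩ := exists_potential (fun x i => crossing Δ C x (x + Pi.single i 1)) (by
    intro x i j
    by_cases hij : i = j
    · subst hij; rfl
    have e : x + Pi.single j 1 + Pi.single i 1 = x + Pi.single i 1 + Pi.single j (1 : ℤ) :=
      add_right_comm _ _ _
    have a1 := adj1_add_single x i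
    have a2 := adj1_add_single x j
    have a3 := adj1_add_single (x + Pi.single i 1) j
    have a4 := adj1_add_single (x + Pi.single j 1) i
    rw [e] at a4
    rw [e]
    have hxp : ∀ k, (x k - (x + Pi.single i 1 + Pi.single j 1 : V d) k).natAbs ≤ 1 := fun k => by
      simp only [Pi.add_apply, Pi.single_apply]
      split_ifs <;> omega
    have hmn : ∀ k, ((x + Pi.single i 1 : V d) k - (x + Pi.single j 1 : V d) k).natAbs ≤ 1 := fun k => by
      simp only [Pi.add_apply, Pi.single_apply]
      split_ifs <;> omega
    generalize x + Pi.single i 1 + Pi.single j 1 = p at *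
    generalize x + Pi.single i 1 = m at *
    generalize x + Pi.single j 1 = n at *
    have hr : ∀ {a b : V d}, (∀ k, (a k - b k).natAbs ≤ 1) → ∀ k, (b k - a k).natAbs ≤ 1 :=
      fun h k => by have := h k; omega
    have l1 := a1.adjS.2
    have l2 := a2.adjS.2
    have l3 := a3.adjS.2
    have l4 := a4.adjS.2
    have q1 : p ∈ Δ → x ∉ Δ → m ∉ Δ → (x ∈ C ↔ m ∈ C) := fun z a b =>
      hC' z a b (hr hxp) (hr l3) a1
    have q2 : p ∈ Δ → x ∉ Δ → n ∉ Δ → (x ∈ C ↔ n ∈ C) := fun z a b =>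
      hC' z a b (hr hxp) (hr l4) a2
    have q3 : n ∈ Δ → x ∉ Δ → m ∉ Δ → (x ∈ C ↔ m ∈ C) := fun z a b =>
      hC' z a b (hr l2) (hr hmn) a1
    have q4 : m ∈ Δ → x ∉ Δ → n ∉ Δ → (x ∈ C ↔ n ∈ C) := fun z a b =>
      hC' z a b (hr l1) hmn a2
    have q5 : x ∈ Δ → m ∉ Δ → p ∉ Δ → (m ∈ C ↔ p ∈ C) := fun z a b =>
      hC' z a b l1 hxp a3
    have q6 : n ∈ Δ → m ∉ Δ → p ∉ Δ → (m ∈ C ↔ p ∈ C) := fun z a b =>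
      hC' z a b (hr hmn) l4 a3
    have q7 : x ∈ Δ → n ∉ Δ → p ∉ Δ → (n ∈ C ↔ p ∈ C) := fun z a b =>
      hC' z a b l2 hxp a4
    have q8 : m ∈ Δ → n ∉ Δ → p ∉ Δ → (n ∈ C ↔ p ∈ C) := fun z a b =>
      hC' z a b hmn l3 a4
    exact crossing_add_crossing q1 q2 q3 q4 q5 q6 q7 q8)
  have hh' : ∀ x y, adj1 x y → h y = h x + crossing Δ C x y := fun x y hxy => by
    obtain ⟨i, rfl | rfl⟩ := hxy.exists_single
    · exact hh x i
    · rw [hh y i, crossing_comm, add_assoc, CharTwo.add_self_eq_zero, add_zero]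
  have hK : ∀ y, y ∉ Δ → h y = h u := fun y hy => by
    have := hconn u hu.2 y hy
    induction this with
    | refl => rfl
    | tail _ hab ih =>
      rw [hh' _ _ hab.2.2, ih hab.1]
      simp [crossing_of_mem_iff_mem, show _ ∉ Δ from hab.1, show _ ∉ Δ from hab.2.1]
  let g : V d → ZMod 2 := fun z => if z ∈ Δ then h z + h u else if z ∈ C then 1 else 0
  have hg : ∀ x y, x ∈ Δ → adjS x y → g x = g y := fun x y hx hxy => by
    refine eq_of_cube g x y hxy.2 fun a b ha hb hab => ?_
    have hxa : ∀ i, (x i - a i).natAbs ≤ 1 := fun i => by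
      have := hxy.2 i
      rcases ha i with h | h <;> rw [h] <;> omega
    have hxb : ∀ i, (x i - b i).natAbs ≤ 1 := fun i => by
      have := hxy.2 i
      rcases hb i with h | h <;> rw [h] <;> omega
    have e := hh' _ _ hab
    by_cases haΔ : a ∈ Δ <;> by_cases hbΔ : b ∈ Δ
    · simp only [g, haΔ, hbΔ, if_true, e]
      simp [crossing_of_mem_iff_mem, haΔ, hbΔ]
    · rw [hK b hbΔ] at e
      simp only [g, haΔ, hbΔ, if_true, if_false, e]
      rw [← add_assoc, CharTwo.add_self_eq_zero, zero_add]
      simp [crossing_of_mem_of_notMem, haΔ, hbΔ]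
    · rw [hK a haΔ] at e
      simp only [g, haΔ, hbΔ, if_true, if_false, e]
      rw [add_right_comm, CharTwo.add_self_eq_zero, zero_add]
      simp [crossing_of_notMem_of_mem, haΔ, hbΔ]
    · simp [g, haΔ, hbΔ, hC' hx haΔ hbΔ hxa hxb hab]
  have hgΔ : ∀ x ∈ Δ, ∀ y ∈ Δ, g x = g y := fun x hx y hy => by
    have := hstar x hx y hy
    induction this with
    | refl => rfl
    | tail _ hab ih => exact (ih hab.1).trans (hg _ _ hab.1 hab.2.2)
  have hb : ∀ z ∈ starBd Δ \ Δ, ∃ a ∈ Δ, g a = g z := fun z hz => by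
    obtain ⟨-, a, ha, hza⟩ | ⟨h1, -⟩ := hz.1
    · exact ⟨a, ha, hg _ _ ha hza.symm⟩
    · exact absurd h1 hz.2
  obtain ⟨a, ha, hau⟩ := hb u hu
  obtain ⟨b, hb, hbv⟩ := hb v hv
  have huv : g u = g v := by rw [← hau, ← hbv, hgΔ a ha b hb]
  by_contra hvC
  simp [g, hu.2, hv.2, huC, hvC] at huv

theorem compIn_symm {d : ℕ} {s : Set (V d)} {x y : V d} (h : y ∈ compIn s x) :
    x ∈ compIn s y := by
  induction h with
  | refl => exact .refl
  | tail _ hab ih => exact .head ⟨hab.2.1, hab.1, hab.2.2.symm⟩ ih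

theorem compIn_eq {d : ℕ} {s : Set (V d)} {x y : V d} (h : y ∈ compIn s x) :
    compIn s y = compIn s x :=
  ext fun _ => ⟨fun hz => Relation.ReflTransGen.trans h hz,
    fun hz => Relation.ReflTransGen.trans (compIn_symm h) hz⟩

theorem compIn_subset {d : ℕ} {s : Set (V d)} {x : V d} (hx : x ∈ s) : compIn s x ⊆ s := by
  intro y hy
  induction hy with
  | refl => exact hx
  | tail _ hab _ => exact hab.2.1

theorem compInS_subset_of_adjS {d : ℕ} {s : Set (V d)} {x y : V d} (hx : x ∈ s) (hy : y ∈ s)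
    (h : adjS x y) : compInS s x ⊆ compInS s y :=
  fun _ hz => Relation.ReflTransGen.head ⟨hy, hx, h.symm⟩ hz

theorem mem_of_adjS_outsideStar {d : ℕ} {Λ : Set (V d)} {x y : V d} (hx : x ∈ outsideStar Λ)
    (hy : y ∉ outsideStar Λ) (h : adjS x y) : y ∈ Λ := by
  by_contra hyΛ
  exact hy ⟨hyΛ, fun hf => hx.2 (hf.subset (compInS_subset_of_adjS hx.1 hyΛ h))⟩

theorem outsideStar_nonempty {d : ℕ} (hd : 0 < d) {Λ : Set (V d)} (hΛ : Λ.Finite) :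
    (outsideStar Λ).Nonempty := by
  let i : Fin d := ⟨0, hd⟩
  obtain ⟨N, hN⟩ := (hΛ.image fun x => x i).bddAbove
  let r : ℕ → V d := fun k => Pi.single i (N + 1 + k)
  have hr : ∀ k, r k ∈ Λᶜ := fun k hk => by
    have := hN (mem_image_of_mem _ hk)
    simp [r] at this
    omega
  have hs : ∀ k, r k ∈ compInS Λᶜ (r 0) := fun k => by
    induction k with
    | zero => exact .refl
    | succ k ih =>
      refine Relation.ReflTransGen.tail ih ⟨hr k, hr _, adj1.adjS ?_⟩
      convert adj1_add_single (r k) i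
      simp only [r, ← Pi.single_add]
      push_cast
      ring_nf
  refine ⟨r 0, hr 0, fun hf => infinite_range_of_injective (f := r) (fun a b hab => ?_)
    (hf.subset (range_subset_iff.2 hs))⟩
  have := congrFun hab i
  simp [r] at this
  exact this

/-- Just outside a level set the height is one below the level. -/
theorem IsLevelSet.eq_sub_one {d : ℕ} {φ : V d → ℤ} (hφ : GH φ) {n : ℤ} {Λ : Set (V d)}
    (hL : IsLevelSet φ n Λ) {x y : V d} (hx : x ∉ Λ) (hy : y ∈ Λ) (h : adj1 x y) :
    φ x = n - 1 := by
  obtain ⟨z, hz, rfl⟩ := hL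
  have hyn : n ≤ φ y := compIn_subset hz hy
  have hxn : ¬ n ≤ φ x := fun hxn =>
    hx (Relation.ReflTransGen.tail hy ⟨hyn, hxn, h.symm⟩)
  have := hφ.2 x y h
  have := le_abs_self (φ y - φ x)
  omega

/-- characterization of outsides of finite level sets. -/
theorem statement19 (d : ℕ) (hd : 2 ≤ d) (Δ : Set (V d)) (hne : Δ ≠ Set.univ)
    (hcof : Δᶜ.Finite) (hstar : ConnSetS Δ) (hconn : ConnSet Δᶜ) :
    ({φ : V d → ℤ | GH φ ∧ ∃ (n : ℤ) (Lset : Set (V d)),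
        IsLevelSet φ n Lset ∧ Lset.Finite ∧ outsideStar Lset = Δ} =
      {φ : V d → ℤ | GH φ ∧ ∃ n : ℤ, (∀ x ∈ starBd Δ ∩ Δ, φ x = n - 1) ∧
        ∀ x ∈ starBd Δ \ Δ, n ≤ φ x}) ∧
    (∀ φ : V d → ℤ, GH φ → ∀ (n m : ℤ) (Ls Ls' : Set (V d)),
      IsLevelSet φ n Ls → Ls.Finite → IsLevelSet φ m Ls' → Ls'.Finite →
      outsideStar Ls = outsideStar Ls' → Ls = Ls') := by
  refine ⟨ext fun φ => ⟨?_, ?_⟩, ?_⟩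
  · rintro ⟨hφ, n, Λ, hL, -, rfl⟩
    refine ⟨hφ, n, ?_, ?_⟩
    · rintro x ⟨⟨h, -⟩ | ⟨-, y, hy, hxy⟩, hx⟩
      · exact absurd hx h
      · exact hL.eq_sub_one hφ hx.1 (mem_of_adjS_outsideStar hx hy hxy.adjS) hxy
    · rintro y ⟨⟨-, x, hx, hyx⟩ | ⟨h, -⟩, hy⟩
      · have hyΛ := mem_of_adjS_outsideStar hx hy hyx.symm
        obtain ⟨z, hz, rfl⟩ := hL
        exact compIn_subset hz hyΛ
      · exact absurd h hy
  · rintro ⟨hφ, n, hin, hout⟩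
    have hinf : Δ.Infinite := fun hf => by
      have : Nonempty (Fin d) := ⟨⟨0, by omega⟩⟩
      exact infinite_univ (α := V d) (by rw [← union_compl_self Δ]; exact hf.union hcof)
    obtain ⟨x₀, hx₀, y₀, hy₀, hxy₀⟩ := exists_adj1_mem_notMem hinf.nonempty hne
    have hy₀B : y₀ ∈ starBd Δ \ Δ := ⟨Or.inl ⟨hy₀, x₀, hx₀, hxy₀.symm.adjS⟩, hy₀⟩
    let Λ := compIn {z : V d | n ≤ φ z} y₀
    have hBΛ : ∀ v ∈ starBd Δ \ Δ, v ∈ Λ := fun v hv =>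
      mem_of_mem_starBd_diff (C := Λ) hstar hconn
        (fun a b ha hb hab haΛ => Relation.ReflTransGen.tail haΛ ⟨hout a ha, hout b hb, hab⟩)
        hy₀B hv Relation.ReflTransGen.refl
    have hΛ : Λ ⊆ Δᶜ := fun z hz => by
      induction hz with
      | refl => exact hy₀
      | @tail b c _ hbc ih =>
        intro hc
        have h1 := hin c ⟨Or.inr ⟨hc, b, ih, hbc.2.2.symm⟩, hc⟩
        have h2 : n ≤ φ c := hbc.2.1
        omega
    refine ⟨hφ, n, Λ, ⟨y₀, hout y₀ hy₀B, rfl⟩, hcof.subset hΛ, ext fun y => ⟨?_, ?_⟩⟩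
    · rintro ⟨hyΛ, hyinf⟩
      by_contra hy
      refine hyinf (hcof.subset fun z hz => ?_)
      induction hz with
      | refl => exact hy
      | @tail b c _ hbc ih =>
        intro hc
        exact hbc.1 (hBΛ b ⟨Or.inl ⟨ih, c, hc, hbc.2.2⟩, ih⟩)
    · intro hy
      refine ⟨fun h => hΛ h hy, fun hf => hinf (hf.subset fun z hz => ?_)⟩
      refine Relation.ReflTransGen.mono (fun a b hab => ?_) _ _ (hstar y hy z hz)
      exact ⟨fun h => hΛ h hab.1, fun h => hΛ h hab.2.1, hab.2.2⟩
  · intro φ hφ n m Ls Ls' hL hLf hL' hLf' hout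
    have hne' : outsideStar Ls ≠ univ := fun h => by
      obtain ⟨z, hz, rfl⟩ := hL
      exact (h.symm ▸ mem_univ z : z ∈ outsideStar _).1 Relation.ReflTransGen.refl
    obtain ⟨x, hx, y, hy, hxy⟩ :=
      exists_adj1_mem_notMem (outsideStar_nonempty (by omega) hLf) hne'
    have hyL := mem_of_adjS_outsideStar hx hy hxy.adjS
    have hxn := hL.eq_sub_one hφ hx.1 hyL hxy
    rw [hout] at hx hy
    have hyL' := mem_of_adjS_outsideStar hx hy hxy.adjS
    have hxm := hL'.eq_sub_one hφ hx.1 hyL' hxy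
    obtain rfl : n = m := by omega
    obtain ⟨z, hz, rfl⟩ := hL
    obtain ⟨z', hz', rfl⟩ := hL'
    rw [← compIn_eq hyL, ← compIn_eq hyL']

end
end
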